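/- arXiv:1610.06376 — 7 statements merged into one kernel-verified Lean document; each statement's English description precedes it below -/
import Mathlib

section
/- For all natural numbers k and all m ≥ 1, the column vector (U_{mk+1}, U_{mk})ᵀ equals the (m−1)-st power of the 2×2 matrix with rows (U_{k+1}, −Q·U_k) and (U_k, U_{k+1} − P·U_k), applied to the column vector (U_{k+1}, U_k)ᵀ. -/
/-- The addition formulas for a Lucas sequence, as the pair at indices `n + k + 1`, `n + k`. -/
theorem lucas_add (P Q : ℤ) (U : ℕ → ℤ)
    (hU0 : U 0 = 0) (hU1 : U 1 = 1)
    (hUrec : ∀ k, U (k + 2) = P * U (k + 1) - Q * U k) (k n : ℕ) :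
    U (n + k + 1) = U (k + 1) * U (n + 1) - Q * U k * U n ∧
      U (n + k) = U k * U (n + 1) + (U (k + 1) - P * U k) * U n := by
  induction n with
  | zero => simp [hU0, hU1]
  | succ n ih =>
    obtain ⟨h₁, h₀⟩ := ih
    have hn := hUrec n
    have hnk := hUrec (n + k)
    rw [show n + 1 + k + 1 = n + k + 2 by ring, show n + 1 + k = n + k + 1 by ring,
      show n + 1 + 1 = n + 2 by ring, hnk, hn, h₁, h₀]
    constructor <;> ring

theorem stmt_2 (P Q : ℤ) (U : ℕ → ℤ)
    (hU0 : U 0 = 0) (hU1 : U 1 = 1)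
    (hUrec : ∀ k, U (k + 2) = P * U (k + 1) - Q * U k) :
    ∀ (k m : ℕ), 1 ≤ m →
      ![U (m * k + 1), U (m * k)] =
        (!![U (k + 1), -Q * U k; U k, U (k + 1) - P * U k] ^ (m - 1)).mulVec
          ![U (k + 1), U k] := by
  intro k m hm
  induction m, hm using Nat.le_induction with
  | base => simp
  | succ m hm ih =>
    obtain ⟨h₁, h₀⟩ := lucas_add P Q U hU0 hU1 hUrec k (m * k)
    rw [show m + 1 - 1 = m - 1 + 1 by omega, pow_succ', ← Matrix.mulVec_mulVec, ← ih,
      add_one_mul m k, h₁, h₀]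
    ext i
    fin_cases i <;> simp [Matrix.mulVec, dotProduct, Fin.sum_univ_two, sub_eq_add_neg]
end

section
/- For every natural number k, W_k = (a₂ − a₁·p − a₀·q)·X_k + (a₁ − a₀·p)·X_{k+1} + a₀·X_{k+2}. -/
theorem stmt_8 (p q r a₀ a₁ a₂ : ℤ) (X W : ℕ → ℤ)
    (hX0 : X 0 = 0) (hX1 : X 1 = 0) (hX2 : X 2 = 1)
    (hXrec : ∀ k, X (k + 3) = p * X (k + 2) + q * X (k + 1) + r * X k)
    (hW0 : W 0 = a₀) (hW1 : W 1 = a₁) (hW2 : W 2 = a₂)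
    (hWrec : ∀ k, W (k + 3) = p * W (k + 2) + q * W (k + 1) + r * W k) :
    ∀ k : ℕ, W k = (a₂ - a₁ * p - a₀ * q) * X k + (a₁ - a₀ * p) * X (k + 1) + a₀ * X (k + 2) := by
  have hX3 : X 3 = p := by simpa [hX0, hX1, hX2] using hXrec 0
  have hX4 : X 4 = p * p + q := by simpa [hX1, hX2, hX3] using hXrec 1
  intro k
  induction k using Nat.strong_induction_on with
  | _ k ih =>
    match k with
    | 0 => simp [hW0, hX0, hX1, hX2]
    | 1 => simp [hW1, hX1, hX2, hX3]
    | 2 => simp [hW2, hX2, hX3, hX4]; ring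
    | k + 3 =>
      have h4 : X (k + 4) = p * X (k + 3) + q * X (k + 2) + r * X (k + 1) := hXrec (k + 1)
      have h5 : X (k + 5) = p * X (k + 4) + q * X (k + 3) + r * X (k + 2) := hXrec (k + 2)
      rw [hWrec, ih (k + 2) (by lia), ih (k + 1) (by lia), ih k (by lia)]
      simp only [add_assoc, Nat.reduceAdd]
      rw [h5, h4, hXrec k]
      ring
end

section
/- For all natural numbers k and all m ≥ 1, the column vector (X_{mk+2}, X_{mk+1}, X_{mk})ᵀ equals the (m−1)-st power of the 3×3 matrix with rows (X_{k+2}, q·X_{k+1} + r·X_k, r·X_{k+1}), (X_{k+1}, X_{k+2} − p·X_{k+1}, r·X_k), (X_k, X_{k+1} − p·X_k, X_{k+2} − p·X_{k+1} − q·X_k), applied to the column vector (X_{k+2}, X_{k+1}, X_k)ᵀ. -/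
/-- The index-shift formulas for a third-order linear recurrence. -/
theorem thirdOrderRec_shift {R : Type*} [CommRing R] (p q r : R) (X : ℕ → R)
    (hX0 : X 0 = 0) (hX1 : X 1 = 0) (hX2 : X 2 = 1)
    (hXrec : ∀ k, X (k + 3) = p * X (k + 2) + q * X (k + 1) + r * X k) (n k : ℕ) :
    X (n + k + 2) = X (k + 2) * X (n + 2) + (q * X (k + 1) + r * X k) * X (n + 1)
        + r * X (k + 1) * X n ∧
      X (n + k + 1) = X (k + 1) * X (n + 2) + (X (k + 2) - p * X (k + 1)) * X (n + 1)
        + r * X k * X n ∧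
      X (n + k) = X k * X (n + 2) + (X (k + 1) - p * X k) * X (n + 1)
        + (X (k + 2) - p * X (k + 1) - q * X k) * X n := by
  induction k with
  | zero => simp [hX0, hX1, hX2]
  | succ k ih =>
    obtain ⟨h2, h1, h0⟩ := ih
    have hk : X (k + 1 + 2) = p * X (k + 2) + q * X (k + 1) + r * X k := hXrec k
    have hnk : X (n + (k + 1) + 2) = p * X (n + k + 2) + q * X (n + k + 1) + r * X (n + k) :=
      hXrec (n + k)
    have e2 : X (k + 1 + 1) = X (k + 2) := rfl
    have e1 : X (n + (k + 1) + 1) = X (n + k + 2) := rfl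
    have e0 : X (n + (k + 1)) = X (n + k + 1) := rfl
    refine ⟨?_, ?_, ?_⟩
    · rw [hnk, hk, e2, h2, h1, h0]; ring
    · rw [e1, hk, e2, h2]; ring
    · rw [e0, hk, e2, h1]; ring

/-- The matrix form of `thirdOrderRec_shift`. -/
theorem thirdOrderRec_mulVec {R : Type*} [CommRing R] (p q r : R) (X : ℕ → R)
    (hX0 : X 0 = 0) (hX1 : X 1 = 0) (hX2 : X 2 = 1)
    (hXrec : ∀ k, X (k + 3) = p * X (k + 2) + q * X (k + 1) + r * X k) (n k : ℕ) :
    !![X (k + 2), q * X (k + 1) + r * X k, r * X (k + 1);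
       X (k + 1), X (k + 2) - p * X (k + 1), r * X k;
       X k, X (k + 1) - p * X k, X (k + 2) - p * X (k + 1) - q * X k].mulVec
        ![X (n + 2), X (n + 1), X n] =
      ![X (n + k + 2), X (n + k + 1), X (n + k)] := by
  obtain ⟨h2, h1, h0⟩ := thirdOrderRec_shift p q r X hX0 hX1 hX2 hXrec n k
  rw [h2, h1, h0]
  ext i
  fin_cases i <;> simp [Matrix.mulVec, dotProduct, Fin.sum_univ_three]

theorem stmt_11 (p q r : ℤ) (X : ℕ → ℤ)
    (hX0 : X 0 = 0) (hX1 : X 1 = 0) (hX2 : X 2 = 1)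
    (hXrec : ∀ k, X (k + 3) = p * X (k + 2) + q * X (k + 1) + r * X k) :
    ∀ (k m : ℕ), 1 ≤ m →
      ![X (m * k + 2), X (m * k + 1), X (m * k)] =
        (!![X (k + 2), q * X (k + 1) + r * X k, r * X (k + 1);
            X (k + 1), X (k + 2) - p * X (k + 1), r * X k;
            X k, X (k + 1) - p * X k, X (k + 2) - p * X (k + 1) - q * X k] ^ (m - 1)).mulVec
          ![X (k + 2), X (k + 1), X k] := by
  intro k m hm
  induction m, hm using Nat.le_induction with
  | base => simp
  | succ m hm ih =>
    obtain ⟨m, rfl⟩ := Nat.exists_eq_add_of_le' hm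
    rw [Nat.add_sub_cancel] at ih ⊢
    rw [pow_succ', ← Matrix.mulVec_mulVec, ← ih,
      thirdOrderRec_mulVec p q r X hX0 hX1 hX2 hXrec, Nat.succ_mul (m + 1) k]
end

section
/- For every natural number k, X_{2k+2} = X_{k+2}² + X_{k+1}·(q·X_{k+1} + 2·r·X_k). -/
/-- Addition formula for the fundamental solution of a third-order linear recurrence. -/
theorem third_order_recurrence_add (p q r : ℤ) (X : ℕ → ℤ)
    (hX0 : X 0 = 0) (hX1 : X 1 = 0) (hX2 : X 2 = 1)
    (hXrec : ∀ k, X (k + 3) = p * X (k + 2) + q * X (k + 1) + r * X k) (n m : ℕ) :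
    X (m + n + 2) =
      X (n + 2) * X (m + 2) + X (n + 1) * (q * X (m + 1) + r * X m) + r * X n * X (m + 1) := by
  induction n generalizing m with
  | zero => simp [hX0, hX1, hX2]
  | succ n ih =>
    have h := ih (m + 1)
    rw [show m + 1 + n + 2 = m + (n + 1) + 2 by ring] at h
    rw [h, show m + 1 + 2 = m + 3 from rfl, show n + 1 + 2 = n + 3 from rfl, hXrec m, hXrec n]
    ring

theorem stmt_12 (p q r : ℤ) (X : ℕ → ℤ)
    (hX0 : X 0 = 0) (hX1 : X 1 = 0) (hX2 : X 2 = 1)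
    (hXrec : ∀ k, X (k + 3) = p * X (k + 2) + q * X (k + 1) + r * X k) :
    ∀ k : ℕ, X (2 * k + 2) = X (k + 2) ^ 2 + X (k + 1) * (q * X (k + 1) + 2 * r * X k) := by
  intro k
  rw [two_mul, third_order_recurrence_add p q r X hX0 hX1 hX2 hXrec k k]
  ring
end

section
/- For every natural number k, X_{2k+1} = r·X_k² + X_{k+1}·(2·X_{k+2} − p·X_{k+1}). -/
/-- Addition formula for the fundamental solution of a third-order linear recurrence. -/
theorem thirdOrder_add_formula (p q r : ℤ) (X : ℕ → ℤ)
    (hX0 : X 0 = 0) (hX1 : X 1 = 0) (hX2 : X 2 = 1)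
    (hXrec : ∀ k, X (k + 3) = p * X (k + 2) + q * X (k + 1) + r * X k) (m n : ℕ) :
    X (m + n + 1) =
      X (m + 2) * X (n + 1) + X (m + 1) * (X (n + 2) - p * X (n + 1)) + r * X m * X n := by
  induction n generalizing m with
  | zero => simp [hX0, hX1, hX2]
  | succ n ih =>
    have h := ih (m + 1)
    rw [show m + 1 + n + 1 = m + (n + 1) + 1 by ring] at h
    rw [h, show m + 1 + 2 = m + 3 by ring, show m + 1 + 1 = m + 2 by ring,
      show n + 1 + 2 = n + 3 by ring, show n + 1 + 1 = n + 2 by ring, hXrec m, hXrec n]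
    ring

theorem stmt_13 (p q r : ℤ) (X : ℕ → ℤ)
    (hX0 : X 0 = 0) (hX1 : X 1 = 0) (hX2 : X 2 = 1)
    (hXrec : ∀ k, X (k + 3) = p * X (k + 2) + q * X (k + 1) + r * X k) :
    ∀ k : ℕ, X (2 * k + 1) = r * X k ^ 2 + X (k + 1) * (2 * X (k + 2) - p * X (k + 1)) := by
  intro k
  rw [two_mul k, thirdOrder_add_formula p q r X hX0 hX1 hX2 hXrec k k]
  ring
end

section
/- For every natural number k, X_{2k+1} = X_{k+2}² + X_{k+1}·(2·X_{k+3} − 2·p₀·X_{k+2} − p₁·X_{k+1}) + p₃·X_k², and X_{2k+3} = X_{k+3}² + X_{k+2}·(p₁·X_{k+2} + 2·p₂·X_{k+1} + 2·p₃·X_k) + p₃·X_{k+1}². -/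
theorem add_formula_of_linear_recurrence_four {R : Type*} [CommRing R] {p₀ p₁ p₂ p₃ : R} {X : ℕ → R}
    (hX0 : X 0 = 0) (hX1 : X 1 = 0) (hX2 : X 2 = 0) (hX3 : X 3 = 1)
    (hXrec : ∀ k, X (k + 4) = p₀ * X (k + 3) + p₁ * X (k + 2) + p₂ * X (k + 1) + p₃ * X k)
    (m n : ℕ) :
    X (m + n + 3) = X (m + 3) * X (n + 3)
      + X (m + 2) * (p₁ * X (n + 2) + p₂ * X (n + 1) + p₃ * X n)
      + X (m + 1) * (p₂ * X (n + 2) + p₃ * X (n + 1)) + p₃ * X m * X (n + 2) := by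
  induction m generalizing n with
  | zero => simp [hX0, hX1, hX2, hX3]
  | succ m ih =>
    have h := ih (n + 1)
    rw [show m + (n + 1) + 3 = m + 1 + n + 3 by ring] at h
    simp only [add_assoc, Nat.reduceAdd] at h hXrec ⊢
    rw [h, hXrec m, hXrec n]
    ring


theorem stmt_18 (p₀ p₁ p₂ p₃ : ℤ) (X : ℕ → ℤ)
    (hX0 : X 0 = 0) (hX1 : X 1 = 0) (hX2 : X 2 = 0) (hX3 : X 3 = 1)
    (hXrec : ∀ k, X (k + 4) = p₀ * X (k + 3) + p₁ * X (k + 2) + p₂ * X (k + 1) + p₃ * X k) :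
    ∀ k : ℕ,
      X (2 * k + 1) = X (k + 2) ^ 2 + X (k + 1) * (2 * X (k + 3) - 2 * p₀ * X (k + 2) - p₁ * X (k + 1)) + p₃ * X k ^ 2 ∧
      X (2 * k + 3) = X (k + 3) ^ 2 + X (k + 2) * (p₁ * X (k + 2) + 2 * p₂ * X (k + 1) + 2 * p₃ * X k) + p₃ * X (k + 1) ^ 2 := by
  intro k
  have add := add_formula_of_linear_recurrence_four hX0 hX1 hX2 hX3 hXrec
  constructor
  · cases k with
    | zero => simp [hX0, hX1, hX2]
    | succ j =>
      rw [show 2 * (j + 1) + 1 = j + j + 3 by ring, add j j]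
      simp only [add_assoc, Nat.reduceAdd] at hXrec ⊢
      rw [hXrec j]
      ring
  · rw [two_mul, add k k]
    ring
end

section
/- For every natural number k, X_{2k} = X_{k+1}·(2·X_{k+2} − p₀·X_{k+1}) + X_k·(2·X_{k+3} − 2·p₀·X_{k+2} − 2·p₁·X_{k+1} − p₂·X_k), and X_{2k+2} = X_{k+2}·(2·X_{k+3} − p₀·X_{k+2}) + X_{k+1}·(p₂·X_{k+1} + 2·p₃·X_k). -/
/-- Addition formula for the fundamental solution of a fourth-order linear recurrence. -/
theorem fundamental_solution_add {R : Type*} [CommRing R] (p₀ p₁ p₂ p₃ : R) (X : ℕ → R)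
    (hX0 : X 0 = 0) (hX1 : X 1 = 0) (hX2 : X 2 = 0) (hX3 : X 3 = 1)
    (hXrec : ∀ k, X (k + 4) = p₀ * X (k + 3) + p₁ * X (k + 2) + p₂ * X (k + 1) + p₃ * X k)
    (m n : ℕ) :
    X (m + n) = X m * X (n + 3) + (X (m + 1) - p₀ * X m) * X (n + 2)
      + (X (m + 2) - p₀ * X (m + 1) - p₁ * X m) * X (n + 1)
      + (X (m + 3) - p₀ * X (m + 2) - p₁ * X (m + 1) - p₂ * X m) * X n := by
  induction m generalizing n with
  | zero => simp [hX0, hX1, hX2, hX3]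
  | succ m ih =>
    rw [Nat.add_right_comm m 1 n, Nat.add_assoc m n 1, ih (n + 1)]
    simp only [Nat.add_assoc, Nat.reduceAdd]
    rw [hXrec n, hXrec m]
    ring

theorem stmt_19 (p₀ p₁ p₂ p₃ : ℤ) (X : ℕ → ℤ)
    (hX0 : X 0 = 0) (hX1 : X 1 = 0) (hX2 : X 2 = 0) (hX3 : X 3 = 1)
    (hXrec : ∀ k, X (k + 4) = p₀ * X (k + 3) + p₁ * X (k + 2) + p₂ * X (k + 1) + p₃ * X k) :
    ∀ k : ℕ,
      X (2 * k) = X (k + 1) * (2 * X (k + 2) - p₀ * X (k + 1)) + X k * (2 * X (k + 3) - 2 * p₀ * X (k + 2) - 2 * p₁ * X (k + 1) - p₂ * X k) ∧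
      X (2 * k + 2) = X (k + 2) * (2 * X (k + 3) - p₀ * X (k + 2)) + X (k + 1) * (p₂ * X (k + 1) + 2 * p₃ * X k) := by
  intro k
  have add := fundamental_solution_add p₀ p₁ p₂ p₃ X hX0 hX1 hX2 hX3 hXrec
  constructor
  · rw [Nat.two_mul, add k k]
    ring
  · rw [show 2 * k + 2 = (k + 1) + (k + 1) by ring, add (k + 1) (k + 1)]
    simp only [Nat.add_assoc, Nat.reduceAdd]
    rw [hXrec k]
    ring
end
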